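/- arXiv:1503.08353 — 3 statements merged into one kernel-verified Lean document; each statement's English description precedes it below -/
import Mathlib

section
/- Let q be a positive integer and let m, n be positive integers. Then ∑_{f | q} ∑_{χ primitive mod f} χ(m) · conj(χ(n)) equals φ(q(mn)) if m ≡ n (mod q(mn)), and equals 0 otherwise. Here the inner sum is over the primitive Dirichlet characters modulo f, for each divisor f of q. -/
/-- `coprimePart q N` is the largest divisor of `q` that is coprime to `N`. -/
def coprimePart (q N : ℕ) : ℕ :=
  Nat.findGreatest (fun d => d ∣ q ∧ Nat.Coprime d N) q

lemma cp_spec (q N : ℕ) (hq : 1 ≤ q) : coprimePart q N ∣ q ∧ Nat.Coprime (coprimePart q N) N :=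
  Nat.findGreatest_spec (P := fun d => d ∣ q ∧ Nat.Coprime d N) (m := 1) hq ⟨one_dvd _, by simp⟩

lemma dvd_cp (q N f : ℕ) (hq : 1 ≤ q) (hf : f ∣ q) (hc : Nat.Coprime f N) :
    f ∣ coprimePart q N := by
  obtain ⟨h1, h2⟩ := cp_spec q N hq
  have hl : Nat.lcm f (coprimePart q N) ∣ q := Nat.lcm_dvd hf h1
  have hlc : Nat.Coprime (Nat.lcm f (coprimePart q N)) N :=
    Nat.Coprime.coprime_dvd_left (Nat.lcm_dvd_mul _ _) (Nat.Coprime.mul_left hc h2)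
  have hle : Nat.lcm f (coprimePart q N) ≤ coprimePart q N :=
    Nat.le_findGreatest (P := fun d => d ∣ q ∧ Nat.Coprime d N) (Nat.le_of_dvd hq hl) ⟨hl, hlc⟩
  have hge := Nat.dvd_lcm_right f (coprimePart q N)
  have hpos : 0 < Nat.lcm f (coprimePart q N) := Nat.pos_of_dvd_of_pos hl hq
  rw [← le_antisymm hle (Nat.le_of_dvd hpos hge)]
  exact Nat.dvd_lcm_left _ _

lemma changeLevel_natCast {f Q : ℕ} (hf : f ∣ Q) (χ : DirichletCharacter ℂ f) {a : ℕ}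
    (ha : Nat.Coprime a Q) :
    DirichletCharacter.changeLevel hf χ (a : ZMod Q) = χ (a : ZMod f) := by
  have := DirichletCharacter.changeLevel_eq_cast_of_dvd' χ hf (a := (a : ℤ))
    (Nat.isCoprime_iff_coprime.mpr ha)
  simpa using this

open Classical in
lemma inner_eq {f Q : ℕ} (hQ : Q ≠ 0) (hf : f ∣ Q) {m n : ℕ}
    (hm : Nat.Coprime m Q) (hn : Nat.Coprime n Q) :
    ∑ᶠ (χ : DirichletCharacter ℂ f) (_ : χ.IsPrimitive),
        χ (m : ZMod f) * (starRingEnd ℂ) (χ (n : ZMod f)) =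
    ∑ᶠ (ψ : DirichletCharacter ℂ Q) (_ : ψ.conductor = f),
        ψ (m : ZMod Q) * (starRingEnd ℂ) (ψ (n : ZMod Q)) := by
  haveI : NeZero Q := ⟨hQ⟩
  haveI : NeZero f := ⟨ne_zero_of_dvd_ne_zero hQ hf⟩
  refine finsum_mem_eq_of_bijOn (s := {χ : DirichletCharacter ℂ f | χ.IsPrimitive})
    (t := {ψ : DirichletCharacter ℂ Q | ψ.conductor = f})
    (DirichletCharacter.changeLevel hf) ⟨?_, ?_, ?_⟩ ?_
  · intro χ hχ
    simp only [Set.mem_setOf_eq] at hχ ⊢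
    rw [DirichletCharacter.conductor_changeLevel]
    exact hχ
  · exact (DirichletCharacter.changeLevel_injective hf).injOn
  · intro ψ hψ
    simp only [Set.mem_setOf_eq] at hψ
    subst hψ
    exact ⟨ψ.primitiveCharacter, ψ.primitiveCharacter_isPrimitive,
      ψ.changeLevel_primitiveCharacter⟩
  · intro χ _
    rw [changeLevel_natCast hf χ hm, changeLevel_natCast hf χ hn]


/-- For positive integers `q`, `m`, `n`,
`∑_{f ∣ q} ∑_{χ primitive mod f} χ(m) conj(χ(n))` equals `φ(q(mn))` when
`m ≡ n (mod q(mn))` and `0` otherwise, where `q(mn)` is the largest divisor of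
`q` coprime to `mn`. -/
theorem primitive_char_orthogonality (q m n : ℕ) (hq : 1 ≤ q) (hm : 1 ≤ m) (hn : 1 ≤ n) :
    ∑ f ∈ q.divisors,
      ∑ᶠ (χ : DirichletCharacter ℂ f) (_ : χ.IsPrimitive),
        χ (m : ZMod f) * (starRingEnd ℂ) (χ (n : ZMod f)) =
    if m ≡ n [MOD coprimePart q (m * n)] then
      (Nat.totient (coprimePart q (m * n)) : ℂ)
    else 0 := by
  classical
  obtain ⟨h1, h2⟩ := cp_spec q (m * n) hq
  have h3 := fun f => dvd_cp q (m * n) f hq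
  generalize coprimePart q (m * n) = Q at *
  have hQ : Q ≠ 0 := ne_zero_of_dvd_ne_zero (by omega) h1
  haveI : NeZero Q := ⟨hQ⟩
  have hmQ : Nat.Coprime m Q := (Nat.Coprime.coprime_dvd_right (dvd_mul_right m n) h2).symm
  have hnQ : Nat.Coprime n Q := (Nat.Coprime.coprime_dvd_right (dvd_mul_left n m) h2).symm
  rw [← Finset.sum_subset (Nat.divisors_subset_of_dvd (by omega) h1)]
  · rw [Finset.sum_congr rfl fun f hf => inner_eq hQ (Nat.dvd_of_mem_divisors hf) hmQ hnQ]
    simp_rw [finsum_eq_if, finsum_eq_sum_of_fintype]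
    rw [Finset.sum_comm]
    have key : ∀ ψ : DirichletCharacter ℂ Q,
        (∑ f ∈ Q.divisors, if ψ.conductor = f then
          ψ (m : ZMod Q) * (starRingEnd ℂ) (ψ (n : ZMod Q)) else 0) =
        ψ ((n : ZMod Q)⁻¹) * ψ (m : ZMod Q) := by
      intro ψ
      rw [Finset.sum_ite_eq, if_pos (Nat.mem_divisors.mpr ⟨ψ.conductor_dvd_level, hQ⟩), mul_comm]
      congr 1
      have hu : (n : ZMod Q) * (n : ZMod Q)⁻¹ = 1 := ZMod.coe_mul_inv_eq_one n hnQ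
      have hs : (starRingEnd ℂ) (ψ (n : ZMod Q)) = ψ⁻¹ (n : ZMod Q) := MulChar.star_apply' ψ _
      rw [hs, MulChar.inv_apply_eq_inv']
      refine inv_eq_of_mul_eq_one_right ?_
      rw [← map_mul, hu, map_one]
    rw [Finset.sum_congr rfl fun ψ _ => key ψ,
      DirichletCharacter.sum_char_inv_mul_char_eq ℂ ((ZMod.isUnit_iff_coprime n Q).mpr hnQ)]
    refine if_congr ?_ rfl rfl
    rw [ZMod.natCast_eq_natCast_iff]
    exact ⟨Nat.ModEq.symm, Nat.ModEq.symm⟩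
  · intro f hf hfQ
    have hfq := Nat.dvd_of_mem_divisors hf
    have hnc : ¬ Nat.Coprime f (m * n) := fun hc => hfQ (Nat.mem_divisors.mpr ⟨h3 f hfq hc, hQ⟩)
    refine finsum_mem_eq_zero_of_forall_eq_zero (s := {χ : DirichletCharacter ℂ f | χ.IsPrimitive}) ?_
    intro χ _
    by_cases hmf : Nat.Coprime m f
    · have hnf : ¬ Nat.Coprime n f := fun h => hnc (Nat.Coprime.mul_right hmf.symm h.symm)
      rw [MulChar.map_nonunit χ (a := (n : ZMod f)) (by rwa [ZMod.isUnit_iff_coprime])]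
      simp
    · rw [MulChar.map_nonunit χ (a := (m : ZMod f)) (by rwa [ZMod.isUnit_iff_coprime])]
      simp
end

section
/- For every integer k ≥ 1, the quantity M_k = ∑_{m ≥ 1} (Λ^{*k}(m))²/m² satisfies M_k ≤ (2k)! + (k/e)^{2k}. -/
open ArithmeticFunction

/-- `Λ^{*k}`, the `k`-fold Dirichlet convolution of the von Mangoldt function
with itself, realized as the `k`-th power of `Λ` in the ring of arithmetic
functions (whose multiplication is Dirichlet convolution). -/
noncomputable def vonMangoldtConv (k : ℕ) : ArithmeticFunction ℝ := vonMangoldt ^ k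

/-- `M_k = ∑_{m ≥ 1} (Λ^{*k}(m))² / m²`. -/
noncomputable def momentConst (k : ℕ) : ℝ :=
  ∑' m : ℕ, (vonMangoldtConv k m) ^ 2 / (m : ℝ) ^ 2

lemma mc_conv_le (k : ℕ) : ∀ m : ℕ, 0 ≤ vonMangoldtConv k m ∧
    (vonMangoldtConv k m ≤ (Real.log m) ^ k) := by
  induction k with
  | zero =>
    intro m
    simp only [vonMangoldtConv, pow_zero, ArithmeticFunction.one_apply]
    split_ifs <;> simp
  | succ k ih =>
    intro m
    have e : vonMangoldtConv (k+1) m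
        = ∑ x ∈ m.divisorsAntidiagonal, vonMangoldtConv k x.1 * vonMangoldt x.2 := by
      simp only [vonMangoldtConv, pow_succ, ArithmeticFunction.mul_apply]
    rw [e]
    refine ⟨Finset.sum_nonneg fun x _ => mul_nonneg (ih x.1).1 vonMangoldt_nonneg, ?_⟩
    calc _ ≤ ∑ x ∈ m.divisorsAntidiagonal, (Real.log m) ^ k * vonMangoldt x.2 := by
          refine Finset.sum_le_sum fun x hx => ?_
          refine mul_le_mul_of_nonneg_right ((ih x.1).2.trans ?_) vonMangoldt_nonneg
          obtain ⟨h1, h2⟩ := Nat.mem_divisorsAntidiagonal.1 hx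
          have hx1 : x.1 ≠ 0 := by rintro h; simp [h] at h1; exact h2 h1.symm
          have hle : x.1 ≤ m := Nat.le_of_dvd (Nat.pos_of_ne_zero h2) ⟨x.2, h1.symm⟩
          refine pow_le_pow_left₀ (Real.log_natCast_nonneg _) ?_ k
          exact Real.log_le_log (by exact_mod_cast Nat.pos_of_ne_zero hx1) (by exact_mod_cast hle)
      _ = (Real.log m) ^ (k+1) := by
          rw [← Finset.mul_sum, pow_succ]
          congr 1
          rw [Nat.sum_divisorsAntidiagonal' (f := fun _ y => vonMangoldt y)]
          exact vonMangoldt_sum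

lemma mc_h (k : ℕ) (hk : 1 ≤ k) (s t : ℝ) (hs : 0 ≤ s) (ht : 0 ≤ t)
    (h : 0 ≤ (t - s) * (k - t)) : s ^ k * Real.exp (-s) ≤ t ^ k * Real.exp (-t) := by
  have hk0 : (0:ℝ) < k := by exact_mod_cast hk
  have h1 : s ≤ t * Real.exp ((s - t) / k) := by
    have := Real.add_one_le_exp ((s - t) / k)
    have h2 : s ≤ t * ((s - t) / k + 1) := by
      have : t * ((s - t) / k + 1) - s = (t - s) * (k - t) / k := by field_simp; ring
      have : 0 ≤ (t - s) * (k - t) / k := by positivity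
      linarith
    exact h2.trans (mul_le_mul_of_nonneg_left this ht)
  have h3 := pow_le_pow_left₀ hs h1 k
  rw [mul_pow, ← Real.exp_nat_mul, mul_div_cancel₀ _ hk0.ne'] at h3
  calc _ ≤ t ^ k * Real.exp (s - t) * Real.exp (-s) :=
        mul_le_mul_of_nonneg_right h3 (Real.exp_pos _).le
    _ = _ := by rw [mul_assoc, ← Real.exp_add]; congr 2; ring

/-- the comparison function -/
noncomputable def mcf (k : ℕ) (x : ℝ) : ℝ := Real.log x ^ (2 * k) / x ^ 2

lemma mcf_eq (k : ℕ) (x : ℝ) (hx : 1 ≤ x) :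
    mcf k x = (Real.log x ^ k * Real.exp (-Real.log x)) ^ 2 := by
  rw [Real.exp_neg, Real.exp_log (by linarith), mcf, mul_pow, inv_pow, div_eq_mul_inv,
    ← pow_mul, mul_comm k 2]

lemma mcf_le (k : ℕ) (hk : 1 ≤ k) (x y : ℝ) (hx : 1 ≤ x) (hy : 1 ≤ y)
    (h : 0 ≤ (Real.log y - Real.log x) * (k - Real.log y)) : mcf k x ≤ mcf k y := by
  rw [mcf_eq k x hx, mcf_eq k y hy]
  have := Real.log_nonneg hx
  exact pow_le_pow_left₀ (by positivity) (mc_h k hk _ _ this (Real.log_nonneg hy) h) 2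

lemma mcf_max (k : ℕ) (hk : 1 ≤ k) (x : ℝ) (hx : 1 ≤ x) :
    mcf k x ≤ ((k : ℝ) / Real.exp 1) ^ (2 * k) := by
  have h := mcf_le k hk x (Real.exp k) hx (Real.one_le_exp (by positivity)) (by simp)
  refine h.trans (le_of_eq ?_)
  rw [mcf, Real.log_exp, div_pow, ← Real.exp_nat_mul, ← Real.exp_nat_mul]
  congr 2; push_cast; ring

/-- truncated exponential -/
noncomputable def mcS (n : ℕ) (t : ℝ) : ℝ := ∑ j ∈ Finset.range (n+1), t ^ j / (j.factorial : ℝ)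

lemma mcS_deriv (n : ℕ) (t : ℝ) : HasDerivAt (mcS n) (mcS n t - t ^ n / (n.factorial : ℝ)) t := by
  induction n with
  | zero =>
    have : mcS 0 = fun _ => 1 := by ext; simp [mcS]
    rw [this]; simpa using hasDerivAt_const t (1:ℝ)
  | succ n ih =>
    have e : mcS (n+1) = fun t => mcS n t + t ^ (n+1) / ((n+1).factorial : ℝ) := by
      ext t; simp only [mcS]; rw [Finset.sum_range_succ _ (n+1)]
    rw [e]
    have h := ih.add ((hasDerivAt_pow (n+1) t).div_const ((n+1).factorial : ℝ))
    refine h.congr_deriv ?_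
    have : (n.factorial : ℝ) ≠ 0 := by positivity
    rw [Nat.factorial_succ]; push_cast
    field_simp
    simp
    ring

/-- antiderivative -/
noncomputable def mcF (k : ℕ) (x : ℝ) : ℝ :=
  -((2*k).factorial : ℝ) * (mcS (2*k) (Real.log x) / x)

lemma mcF_deriv (k : ℕ) (x : ℝ) (hx : 0 < x) : HasDerivAt (mcF k) (mcf k x) x := by
  have h1 := (mcS_deriv (2*k) (Real.log x)).comp x (Real.hasDerivAt_log hx.ne')
  have h := (h1.div (hasDerivAt_id x) hx.ne').const_mul (-((2*k).factorial : ℝ))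
  refine h.congr_deriv ?_
  have : ((2*k).factorial : ℝ) ≠ 0 := by positivity
  simp only [Function.comp, id, mcf]
  field_simp
  ring

lemma mcF_one (k : ℕ) : mcF k 1 = -((2*k).factorial : ℝ) := by
  simp [mcF, mcS, Finset.sum_range_succ']

lemma mcF_nonpos (k : ℕ) (x : ℝ) (hx : 1 ≤ x) : mcF k x ≤ 0 := by
  have h := Real.log_nonneg hx
  have : 0 ≤ mcS (2*k) (Real.log x) := Finset.sum_nonneg fun j _ => by positivity
  have : 0 ≤ ((2*k).factorial : ℝ) * (mcS (2*k) (Real.log x) / x) := by positivity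
  simp only [mcF]; linarith

lemma mcF_mvt (k : ℕ) (x : ℝ) (hx : 1 ≤ x) :
    ∃ c, x < c ∧ c < x + 1 ∧ mcf k c = mcF k (x+1) - mcF k x := by
  obtain ⟨c, hc, h⟩ := exists_hasDerivAt_eq_slope (mcF k) (mcf k) (lt_add_one x)
    (fun y hy => (mcF_deriv k y (by linarith [hy.1])).continuousAt.continuousWithinAt)
    (fun y hy => mcF_deriv k y (by linarith [hy.1]))
  exact ⟨c, hc.1, hc.2, by rw [h]; simp⟩

lemma mc_sum (k : ℕ) (hk : 1 ≤ k) (N : ℕ) :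
    ∑ m ∈ Finset.range (N+1), mcf k ((m:ℝ) + 1) ≤ mcF k ((N:ℝ)+1) - mcF k 1 +
      if Real.log ((N:ℝ)+1) ≤ k then mcf k ((N:ℝ)+1) else ((k : ℝ) / Real.exp 1) ^ (2 * k) := by
  induction N with
  | zero => simp
  | succ N ih =>
    rw [Finset.sum_range_succ]
    push_cast
    have hx : (1:ℝ) ≤ (N:ℝ)+1 := le_add_of_nonneg_left (Nat.cast_nonneg N)
    generalize (N:ℝ)+1 = x at *
    obtain ⟨c, hc1, hc2, hc⟩ := mcF_mvt k x hx
    have l1 := Real.log_le_log (by linarith) hc1.le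
    have l2 := Real.log_le_log (by linarith) hc2.le
    have m1 := mcf_max k hk x hx
    have m2 := mcf_max k hk (x+1) (by linarith)
    have a1 : Real.log c ≤ k → mcf k x ≤ mcf k c := fun h =>
      mcf_le k hk _ _ hx (by linarith) (mul_nonneg (by linarith) (by linarith))
    have a2 : k ≤ Real.log c → mcf k (x+1) ≤ mcf k c := fun h =>
      mcf_le k hk _ _ (by linarith) (by linarith)
        (mul_nonneg_of_nonpos_of_nonpos (by linarith) (by linarith))
    split_ifs at ih ⊢ with i1 i2 i2
    · linarith [a1 (by linarith)]
    · linarith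
    · rcases le_total (Real.log c) k with h | h
      · linarith [a1 h]
      · linarith [a2 h]
    · linarith [a2 (by linarith)]

/-- For every `k ≥ 1`, `M_k ≤ (2k)! + (k/e)^{2k}`. -/
theorem momentConst_le (k : ℕ) (hk : 1 ≤ k) :
    momentConst k ≤ (Nat.factorial (2 * k) : ℝ) + ((k : ℝ) / Real.exp 1) ^ (2 * k) := by
  refine Real.tsum_le_of_sum_range_le (fun m => by positivity) fun n => ?_
  have key : ∀ n : ℕ, ∑ i ∈ Finset.range (n+2), (vonMangoldtConv k i) ^ 2 / (i : ℝ) ^ 2 ≤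
      (Nat.factorial (2 * k) : ℝ) + ((k : ℝ) / Real.exp 1) ^ (2 * k) := by
    intro n
    rw [Finset.sum_range_succ']
    have h := mc_sum k hk n
    have hx : (1:ℝ) ≤ (n:ℝ)+1 := le_add_of_nonneg_left (Nat.cast_nonneg n)
    have h0 := mcF_nonpos k _ hx
    have h2 := mcf_max k hk _ hx
    rw [mcF_one] at h
    have h3 : ∑ i ∈ Finset.range (n+1), (vonMangoldtConv k (i+1)) ^ 2 / ((i+1 : ℕ) : ℝ) ^ 2
        ≤ ∑ m ∈ Finset.range (n+1), mcf k ((m:ℝ) + 1) := by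
      refine Finset.sum_le_sum fun i _ => ?_
      obtain ⟨p, q⟩ := mc_conv_le k (i+1)
      have := pow_le_pow_left₀ p q 2
      rw [mcf, mul_comm 2 k, pow_mul]
      push_cast at this ⊢
      gcongr
    simp only [ArithmeticFunction.map_zero, Nat.cast_zero]
    norm_num
    push_cast at h3
    split_ifs at h <;> linarith
  refine le_trans ?_ (key n)
  exact Finset.sum_le_sum_of_subset_of_nonneg (Finset.range_mono (by omega))
    fun _ _ _ => by positivity
end

section
/- Let k ≥ 1 be an integer and ε > 0. There is a constant C(ε, k) such that for every prime q and every real X ≥ 2: ∑_{m₁,…,m_k,n₁,…,n_k ≥ 1, q | m̄, m̄ = n̄} (∏_{i=1}^{k} Λ(m_i)Λ(n_i)) · e^{−m̄²/X}/m̄² ≤ C(ε, k) · e^{−q²/X} / q^{2(1−ε)}, where m̄ = m₁⋯m_k and n̄ = n₁⋯n_k. -/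
open ArithmeticFunction

theorem fiber_bound (k m : ℕ) (hm : m ≠ 0) :
    ∑ f ∈ Nat.finMulAntidiag k m, ∏ i, vonMangoldt (f i) ≤ Real.log m ^ k := by
  have h1 : Nat.finMulAntidiag k m ⊆ Fintype.piFinset (fun _ : Fin k => m.divisors) := by
    intro f hf
    rw [Nat.mem_finMulAntidiag] at hf
    rw [Fintype.mem_piFinset]
    intro i
    rw [Nat.mem_divisors]
    exact ⟨hf.1 ▸ Finset.dvd_prod_of_mem f (Finset.mem_univ i), hm⟩
  refine (Finset.sum_le_sum_of_subset_of_nonneg h1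
    (fun f _ _ => Finset.prod_nonneg fun i _ => vonMangoldt_nonneg)).trans ?_
  rw [← Finset.prod_univ_sum (fun _ : Fin k => m.divisors) (fun _ d => vonMangoldt d)]
  simp [vonMangoldt_sum]

theorem log_bound (k m : ℕ) (η : ℝ) (hη : 0 < η) (hm : m ≠ 0) :
    (Real.log m ^ k) ^ 2 ≤ (η⁻¹ ^ k) ^ 2 * (m : ℝ) ^ (η * (2 * k)) := by
  have hm1 : (1 : ℝ) ≤ m := by exact_mod_cast Nat.one_le_iff_ne_zero.mpr hm
  have h := Real.log_le_rpow_div (x := (m : ℝ)) (by positivity) hη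
  have h0 := Real.log_nonneg hm1
  calc (Real.log m ^ k) ^ 2 ≤ (((m : ℝ) ^ η / η) ^ k) ^ 2 := by gcongr
    _ = _ := by
      rw [Real.rpow_mul (by positivity), div_eq_mul_inv, mul_pow, mul_pow, ← pow_mul ((m : ℝ) ^ η),
        show (2 * (k : ℝ)) = ((k * 2 : ℕ) : ℝ) by push_cast; ring, Real.rpow_natCast]
      ring

/-- Let `k ≥ 1`, `ε > 0`. There is `C(ε,k)` such that for
every prime `q` and real `X ≥ 2`, the sum over tuples with `q ∣ m̄` and
`m̄ = n̄` of `(∏ Λ(mᵢ)Λ(nᵢ)) e^{-m̄²/X}/m̄²` is at most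
`C(ε,k) · e^{-q²/X} / q^{2(1-ε)}`. -/
theorem fourth_case_bound (k : ℕ) (hk : 1 ≤ k) (ε : ℝ) (hε : 0 < ε) :
    ∃ C : ℝ, ∀ q : ℕ, q.Prime → ∀ X : ℝ, 2 ≤ X →
      (∑' p : (Fin k → ℕ) × (Fin k → ℕ),
          if (∀ i, 1 ≤ p.1 i) ∧ (∀ i, 1 ≤ p.2 i) ∧
              q ∣ (∏ i, p.1 i) ∧ (∏ i, p.1 i) = (∏ i, p.2 i) then
            (∏ i, vonMangoldt (p.1 i) * vonMangoldt (p.2 i)) *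
              Real.exp (-(((∏ i, p.1 i : ℕ)) : ℝ) ^ 2 / X) /
              ((∏ i, p.1 i : ℕ) : ℝ) ^ 2
          else 0) ≤
      C * Real.exp (-((q : ℝ)) ^ 2 / X) / (q : ℝ) ^ (2 * (1 - ε)) := by
  set δ : ℝ := min (2 * ε) (1 / 2) with hδ
  have hδ0 : 0 < δ := by rw [hδ]; positivity
  have hδ1 : δ ≤ 1 / 2 := min_le_right _ _
  have hδ2 : δ ≤ 2 * ε := min_le_left _ _
  have hk0 : (0 : ℝ) < k := by exact_mod_cast hk
  set η : ℝ := δ / (2 * k) with hη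
  have hη0 : 0 < η := by positivity
  have hηk : η * (2 * k) = δ := by rw [hη]; field_simp
  have hsum : Summable (fun r : ℕ => (r : ℝ) ^ (δ - 2)) :=
    Real.summable_nat_rpow.mpr (by linarith)
  set S : ℝ := ∑' r : ℕ, (r : ℝ) ^ (δ - 2) with hS
  have hS0 : 0 ≤ S := tsum_nonneg fun r => by positivity
  set K : ℝ := (η⁻¹ ^ k) ^ 2 with hK
  have hK0 : 0 ≤ K := by positivity
  refine ⟨K * S, fun q hq X hX => ?_⟩
  have hq0 : q ≠ 0 := hq.ne_zero
  have hq1 : (1 : ℝ) ≤ q := by exact_mod_cast hq.one_le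
  have hqp : (0 : ℝ) < q := by linarith
  set E : ℝ := Real.exp (-((q : ℝ)) ^ 2 / X) with hE
  have hE0 : 0 < E := Real.exp_pos _
  have hX0 : 0 < X := by linarith
  have hfin : K * S * E * (q : ℝ) ^ (δ - 2) ≤ K * S * E / (q : ℝ) ^ (2 * (1 - ε)) := by
    rw [div_eq_mul_inv, ← Real.rpow_neg hqp.le]
    gcongr
    linarith
  refine le_trans ?_ hfin
  have hL : 0 ≤ K * S * E * (q : ℝ) ^ (δ - 2) := by positivity
  apply tsum_le_of_sum_le' hL
  intro s
  rw [← Finset.sum_filter]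
  set s' := s.filter (fun p : (Fin k → ℕ) × (Fin k → ℕ) => (∀ i, 1 ≤ p.1 i) ∧ (∀ i, 1 ≤ p.2 i) ∧
              q ∣ (∏ i, p.1 i) ∧ (∏ i, p.1 i) = (∏ i, p.2 i)) with hs'
  let g : (Fin k → ℕ) × (Fin k → ℕ) → ℕ := fun p => (∏ i, p.1 i) / q
  rw [← Finset.sum_fiberwise_of_maps_to (s := s') (t := s'.image g) (g := g)
    (fun p hp => Finset.mem_image_of_mem g hp)]
  have key : ∀ r ∈ s'.image g,
      ∑ p ∈ s' with g p = r, ((∏ i, vonMangoldt (p.1 i) * vonMangoldt (p.2 i)) *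
              Real.exp (-(((∏ i, p.1 i : ℕ)) : ℝ) ^ 2 / X) /
              ((∏ i, p.1 i : ℕ) : ℝ) ^ 2) ≤ K * E * (q : ℝ) ^ (δ - 2) * (r : ℝ) ^ (δ - 2) := by
    intro r hr
    have hmem : ∀ p ∈ s'.filter (fun p => g p = r), (∏ i, p.1 i) = q * r ∧ (∏ i, p.2 i) = q * r
        ∧ q * r ≠ 0 := by
      intro p hp
      simp only [hs', Finset.mem_filter] at hp
      obtain ⟨⟨_, h1, h2, h3, h4⟩, h5⟩ := hp
      have h6 : (∏ i, p.1 i) = q * r := by rw [← h5]; exact (Nat.mul_div_cancel' h3).symm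
      refine ⟨h6, h4 ▸ h6, ?_⟩
      rw [← h6]
      exact Finset.prod_ne_zero_iff.mpr fun i _ => Nat.one_le_iff_ne_zero.mp (h1 i)
    have hne : q * r ≠ 0 := by
      obtain ⟨p, hp, hpr⟩ := Finset.mem_image.mp hr
      exact (hmem p (Finset.mem_filter.mpr ⟨hp, hpr⟩)).2.2
    have hr0 : r ≠ 0 := right_ne_zero_of_mul hne
    have hr1 : (1 : ℝ) ≤ r := by exact_mod_cast Nat.one_le_iff_ne_zero.mpr hr0
    have hmp : (0 : ℝ) < ((q * r : ℕ) : ℝ) := by exact_mod_cast Nat.pos_of_ne_zero hne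
    have hqm : (q : ℝ) ≤ ((q * r : ℕ) : ℝ) := by push_cast; nlinarith
    have hsub : s'.filter (fun p => g p = r) ⊆
        Nat.finMulAntidiag k (q * r) ×ˢ Nat.finMulAntidiag k (q * r) := by
      intro p hp
      obtain ⟨h1, h2, h3⟩ := hmem p hp
      simp only [Finset.mem_product, Nat.mem_finMulAntidiag]
      exact ⟨⟨h1, h3⟩, h2, h3⟩
    have hlog0 : 0 ≤ ∑ f ∈ Nat.finMulAntidiag k (q * r), ∏ i, vonMangoldt (f i) :=
      Finset.sum_nonneg fun f _ => Finset.prod_nonneg fun i _ => vonMangoldt_nonneg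
    calc _ ≤ ∑ p ∈ s' with g p = r, ((∏ i, vonMangoldt (p.1 i)) * (∏ i, vonMangoldt (p.2 i))) *
              (E / ((q * r : ℕ) : ℝ) ^ 2) := by
          apply Finset.sum_le_sum
          intro p hp
          rw [(hmem p hp).1, Finset.prod_mul_distrib, mul_div_assoc]
          have h1 : 0 ≤ ∏ i, vonMangoldt (p.1 i) :=
            Finset.prod_nonneg fun i _ => vonMangoldt_nonneg
          have h2 : 0 ≤ ∏ i, vonMangoldt (p.2 i) :=
            Finset.prod_nonneg fun i _ => vonMangoldt_nonneg
          rw [hE]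
          gcongr
      _ ≤ ∑ p ∈ Nat.finMulAntidiag k (q * r) ×ˢ Nat.finMulAntidiag k (q * r),
            ((∏ i, vonMangoldt (p.1 i)) * (∏ i, vonMangoldt (p.2 i))) *
              (E / ((q * r : ℕ) : ℝ) ^ 2) := by
          apply Finset.sum_le_sum_of_subset_of_nonneg hsub
          intro p _ _
          have h1 : 0 ≤ ∏ i, vonMangoldt (p.1 i) :=
            Finset.prod_nonneg fun i _ => vonMangoldt_nonneg
          have h2 : 0 ≤ ∏ i, vonMangoldt (p.2 i) :=
            Finset.prod_nonneg fun i _ => vonMangoldt_nonneg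
          positivity
      _ = (∑ f ∈ Nat.finMulAntidiag k (q * r), ∏ i, vonMangoldt (f i)) ^ 2 *
              (E / ((q * r : ℕ) : ℝ) ^ 2) := by
          rw [← Finset.sum_mul, Finset.sum_product, sq (∑ f ∈ Nat.finMulAntidiag k (q * r), _), Finset.sum_mul_sum]
      _ ≤ (Real.log (q * r : ℕ) ^ k) ^ 2 * (E / ((q * r : ℕ) : ℝ) ^ 2) := by
          have := fiber_bound k (q * r) hne
          gcongr
      _ ≤ (K * ((q * r : ℕ) : ℝ) ^ δ) * (E / ((q * r : ℕ) : ℝ) ^ 2) := by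
          have := log_bound k (q * r) η hη0 hne
          rw [hηk] at this
          gcongr
      _ = K * E * ((q * r : ℕ) : ℝ) ^ (δ - 2) := by
          rw [Real.rpow_sub hmp, Real.rpow_two]
          ring
      _ = _ := by
          push_cast
          rw [Real.mul_rpow (by positivity) (by positivity)]
          ring
  refine (Finset.sum_le_sum key).trans ?_
  rw [← Finset.mul_sum]
  have h := hsum.sum_le_tsum (s'.image g) (fun r _ => by positivity)
  calc _ ≤ K * E * (q : ℝ) ^ (δ - 2) * S := by gcongr
    _ = _ := by ring
end
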